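/- arXiv:2410.15564 — 2 statements merged into one kernel-verified Lean document; each statement's English description precedes it below -/
import Mathlib

section
/- Let ξ ∈ (0,1) and μ ∈ (0,1). For every λ ∈ ℝ with 1 + λ·(1 - ξ) > 0 and 1 - λ·ξ > 0, it holds that μ·log(1 + λ·(1 - ξ)) + (1 - μ)·log(1 - λ·ξ) ≤ μ·log(μ/ξ) + (1 - μ)·log((1 - μ)/(1 - ξ)), and equality holds when λ = (μ - ξ)/(ξ·(1 - ξ)). -/
/-- Tangent-line bound for the logarithm at `p / q`, scaled by `p`. -/
theorem mul_log_le_mul_log_div_add {p q x : ℝ} (hp : 0 < p) (hq : 0 < q) (hx : 0 < x) :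
    p * Real.log x ≤ p * Real.log (p / q) + (x * q - p) := by
  have h := Real.log_le_sub_one_of_pos (div_pos hx (div_pos hp hq))
  rw [Real.log_div hx.ne' (div_pos hp hq).ne'] at h
  have h' := mul_le_mul_of_nonneg_left h hp.le
  have e : p * (x / (p / q) - 1) = x * q - p := by field_simp
  linarith

/-- Maximization over the betting fraction (proof of Theorem 1): for `ξ, μ ∈ (0,1)`, over all
`l` with `1 + l (1-ξ) > 0` and `1 - l ξ > 0`, the quantity
`μ log (1 + l (1-ξ)) + (1-μ) log (1 - l ξ)` is at most the KL divergence
`μ log (μ/ξ) + (1-μ) log ((1-μ)/(1-ξ))`, with equality at `l = (μ-ξ)/(ξ(1-ξ))`. -/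
theorem stmt_4 (ξ μ : ℝ) (hξ : ξ ∈ Set.Ioo (0:ℝ) 1) (hμ : μ ∈ Set.Ioo (0:ℝ) 1) :
    (∀ l : ℝ, 0 < 1 + l * (1 - ξ) → 0 < 1 - l * ξ →
      μ * Real.log (1 + l * (1 - ξ)) + (1 - μ) * Real.log (1 - l * ξ)
        ≤ μ * Real.log (μ / ξ) + (1 - μ) * Real.log ((1 - μ) / (1 - ξ))) ∧
    (μ * Real.log (1 + ((μ - ξ) / (ξ * (1 - ξ))) * (1 - ξ))
        + (1 - μ) * Real.log (1 - ((μ - ξ) / (ξ * (1 - ξ))) * ξ)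
      = μ * Real.log (μ / ξ) + (1 - μ) * Real.log ((1 - μ) / (1 - ξ))) := by
  obtain ⟨hξ0, hξ1⟩ := hξ
  obtain ⟨hμ0, hμ1⟩ := hμ
  have hξ' : 0 < 1 - ξ := sub_pos.2 hξ1
  have hμ' : 0 < 1 - μ := sub_pos.2 hμ1
  refine ⟨fun l h1 h2 => ?_, ?_⟩
  · linarith [mul_log_le_mul_log_div_add hμ0 hξ0 h1, mul_log_le_mul_log_div_add hμ' hξ' h2]
  · have e1 : 1 + ((μ - ξ) / (ξ * (1 - ξ))) * (1 - ξ) = μ / ξ := by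
      field_simp
      ring
    have e2 : 1 - ((μ - ξ) / (ξ * (1 - ξ))) * ξ = (1 - μ) / (1 - ξ) := by
      field_simp
      ring
    rw [e1, e2]
end

section
/- Let ξ ∈ (0,1) and μ ∈ (ξ, 1). Then the infimum, over all probability measures P on ℝ with P([0,1]) = 1 and mean ∫ x dP(x) = μ, of the supremum over λ ∈ [0, 1/ξ) of ∫ log(1 + λ·(x - ξ)) dP(x), equals d(μ, ξ) := μ·log(μ/ξ) + (1 - μ)·log((1 - μ)/(1 - ξ)). -/
open MeasureTheory

lemma ae_mem_Icc_of_measure_eq_one (P : Measure ℝ) [IsProbabilityMeasure P]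
    (hP : P (Set.Icc (0 : ℝ) 1) = 1) : ∀ᵐ x ∂P, x ∈ Set.Icc (0 : ℝ) 1 :=
  (prob_compl_eq_zero_iff measurableSet_Icc).2 hP

lemma log_one_add_mul_mem_Icc {ξ l x : ℝ} (hξ : ξ ∈ Set.Ioo (0 : ℝ) 1)
    (hl : l ∈ Set.Ico (0 : ℝ) (1 / ξ)) (hx : x ∈ Set.Icc (0 : ℝ) 1) :
    Real.log (1 + l * (x - ξ)) ∈ Set.Icc (Real.log (1 - l * ξ)) (Real.log (1 / ξ)) := by
  obtain ⟨hξ0, hξ1⟩ := hξ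
  obtain ⟨hl0, hl1⟩ := hl
  have hlξ : l * ξ < 1 := (lt_div_iff₀ hξ0).1 hl1
  have hlx : 0 ≤ l * x := mul_nonneg hl0 hx.1
  have hlx' : l * (x - ξ) ≤ 1 / ξ * (1 - ξ) :=
    (mul_le_mul_of_nonneg_left (by linarith [hx.2]) hl0).trans
      (mul_le_mul_of_nonneg_right hl1.le (by linarith))
  have h1 : 1 / ξ * (1 - ξ) = 1 / ξ - 1 := by field_simp
  exact ⟨Real.log_le_log (by linarith) (by linarith),
    Real.log_le_log (by linarith) (by linarith)⟩

lemma integrable_log_one_add_mul {ξ l : ℝ} (hξ : ξ ∈ Set.Ioo (0 : ℝ) 1)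
    (hl : l ∈ Set.Ico (0 : ℝ) (1 / ξ)) (P : Measure ℝ) [IsProbabilityMeasure P]
    (hP : P (Set.Icc (0 : ℝ) 1) = 1) :
    Integrable (fun x => Real.log (1 + l * (x - ξ))) P :=
  Integrable.of_mem_Icc _ _
    (Real.measurable_log.comp (by fun_prop : Measurable fun x : ℝ => 1 + l * (x - ξ))).aemeasurable
    ((ae_mem_Icc_of_measure_eq_one P hP).mono fun _ hx => log_one_add_mul_mem_Icc hξ hl hx)

lemma bddAbove_range_integral_log {ξ : ℝ} (hξ : ξ ∈ Set.Ioo (0 : ℝ) 1) (P : Measure ℝ)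
    [IsProbabilityMeasure P] (hP : P (Set.Icc (0 : ℝ) 1) = 1) :
    BddAbove (Set.range fun l : Set.Ico (0 : ℝ) (1 / ξ) =>
      ∫ x, Real.log (1 + (l : ℝ) * (x - ξ)) ∂P) := by
  refine ⟨Real.log (1 / ξ), ?_⟩
  rintro _ ⟨l, rfl⟩
  have h := integral_mono_ae (integrable_log_one_add_mul hξ l.2 P hP)
    (integrable_const (Real.log (1 / ξ)))
    ((ae_mem_Icc_of_measure_eq_one P hP).mono fun _ hx => (log_one_add_mul_mem_Icc hξ l.2 hx).2)
  simpa using h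

/-- The bet that is optimal against the Bernoulli distribution of mean `μ`. -/
lemma optimal_bet_mem_Ico {ξ μ : ℝ} (hξ : ξ ∈ Set.Ioo (0 : ℝ) 1) (hμ : μ ∈ Set.Ioo ξ 1) :
    (μ - ξ) / (ξ * (1 - ξ)) ∈ Set.Ico (0 : ℝ) (1 / ξ) := by
  obtain ⟨hξ0, hξ1⟩ := hξ
  obtain ⟨hμ0, hμ1⟩ := hμ
  have h1 : 0 < 1 - ξ := by linarith
  refine ⟨div_nonneg (by linarith) (by positivity), ?_⟩
  rw [div_lt_div_iff₀ (by positivity) hξ0]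
  nlinarith

/-- By concavity of the logarithm, the growth rate of a bet is smallest on Bernoulli
distributions. -/
lemma bernoulli_growth_le_integral_log {ξ μ l : ℝ} (hξ : ξ ∈ Set.Ioo (0 : ℝ) 1)
    (hl : l ∈ Set.Ico (0 : ℝ) (1 / ξ)) (P : Measure ℝ) [IsProbabilityMeasure P]
    (hP : P (Set.Icc (0 : ℝ) 1) = 1) (hmean : ∫ x, x ∂P = μ) :
    (1 - μ) * Real.log (1 + l * (0 - ξ)) + μ * Real.log (1 + l * (1 - ξ))
      ≤ ∫ x, Real.log (1 + l * (x - ξ)) ∂P := by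
  have hae := ae_mem_Icc_of_measure_eq_one P hP
  have hid : Integrable (fun x : ℝ => x) P :=
    Integrable.of_mem_Icc 0 1 measurable_id.aemeasurable hae
  set a := Real.log (1 + l * (0 - ξ)) with ha
  set b := Real.log (1 + l * (1 - ξ)) with hb
  have hint : ∫ x, (a + x * (b - a)) ∂P = (1 - μ) * a + μ * b := by
    rw [integral_add (integrable_const _) (hid.mul_const _), integral_mul_const, hmean]
    simp
    ring
  rw [← hint]
  refine integral_mono_ae ((integrable_const _).add (hid.mul_const _))
    (integrable_log_one_add_mul hξ hl P hP) (hae.mono fun x hx => ?_)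
  have hlξ : l * ξ < 1 := (lt_div_iff₀ hξ.1).1 hl.2
  have hA : 0 < 1 + l * (0 - ξ) := by linarith
  have hB : 0 < 1 + l * (1 - ξ) := by linarith [hl.1]
  have h := strictConcaveOn_log_Ioi.concaveOn.2 hA hB (sub_nonneg.2 hx.2) hx.1 (by ring)
  simp only [smul_eq_mul, ← ha, ← hb] at h
  calc a + x * (b - a) = (1 - x) * a + x * b := by ring
    _ ≤ _ := h
    _ = Real.log (1 + l * (x - ξ)) := by ring_nf

lemma bernoulli_growth_optimal_bet {ξ μ : ℝ} (hξ : ξ ∈ Set.Ioo (0 : ℝ) 1) :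
    (1 - μ) * Real.log (1 + (μ - ξ) / (ξ * (1 - ξ)) * (0 - ξ))
      + μ * Real.log (1 + (μ - ξ) / (ξ * (1 - ξ)) * (1 - ξ))
      = μ * Real.log (μ / ξ) + (1 - μ) * Real.log ((1 - μ) / (1 - ξ)) := by
  have h0 : ξ ≠ 0 := hξ.1.ne'
  have h1 : 1 - ξ ≠ 0 := (sub_pos.2 hξ.2).ne'
  have hA : 1 + (μ - ξ) / (ξ * (1 - ξ)) * (0 - ξ) = (1 - μ) / (1 - ξ) := by
    field_simp
    ring
  have hB : 1 + (μ - ξ) / (ξ * (1 - ξ)) * (1 - ξ) = μ / ξ := by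
    field_simp
    ring
  rw [hA, hB, add_comm]

lemma bernoulli_growth_le {ξ μ l : ℝ} (hξ : ξ ∈ Set.Ioo (0 : ℝ) 1) (hμ : μ ∈ Set.Ioo (0 : ℝ) 1)
    (hl : l ∈ Set.Ico (0 : ℝ) (1 / ξ)) :
    (1 - μ) * Real.log (1 + l * (0 - ξ)) + μ * Real.log (1 + l * (1 - ξ))
      ≤ μ * Real.log (μ / ξ) + (1 - μ) * Real.log ((1 - μ) / (1 - ξ)) := by
  obtain ⟨hξ0, hξ1⟩ := hξ
  obtain ⟨hμ0, hμ1⟩ := hμ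
  have hξ' : 0 < 1 - ξ := by linarith
  have hμ' : 0 < 1 - μ := by linarith
  have hlξ : l * ξ < 1 := (lt_div_iff₀ hξ0).1 hl.2
  have hA : 0 < 1 + l * (0 - ξ) := by linarith
  have hB : 0 < 1 + l * (1 - ξ) := by linarith [hl.1]
  have key : ∀ {p q c : ℝ}, 0 < p → 0 < q → 0 < c →
      p * Real.log c ≤ p * Real.log (p / q) + (c * q - p) := by
    intro p q c hp hq hc
    have h := Real.log_le_sub_one_of_pos (div_pos hc (div_pos hp hq))
    rw [Real.log_div hc.ne' (div_pos hp hq).ne'] at h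
    have h2 := mul_le_mul_of_nonneg_left h hp.le
    have h3 : p * (c / (p / q) - 1) = c * q - p := by field_simp
    linarith
  have h1 := key hμ' hξ' hA
  have h2 := key hμ0 hξ0 hB
  nlinarith

/-- The Bernoulli distribution of mean `μ`, as a measure on `ℝ`. -/
noncomputable def bernoulliReal (μ : ℝ) : Measure ℝ :=
  ENNReal.ofReal (1 - μ) • Measure.dirac 0 + ENNReal.ofReal μ • Measure.dirac 1

lemma integral_bernoulliReal {μ : ℝ} (hμ : μ ∈ Set.Ioo (0 : ℝ) 1) (f : ℝ → ℝ) :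
    ∫ x, f x ∂(bernoulliReal μ) = (1 - μ) * f 0 + μ * f 1 := by
  have h (a : ℝ) : Integrable f (Measure.dirac a) := integrable_dirac (by simp)
  rw [bernoulliReal, integral_add_measure ((h 0).smul_measure ENNReal.ofReal_ne_top)
    ((h 1).smul_measure ENNReal.ofReal_ne_top), integral_smul_measure, integral_smul_measure]
  simp [ENNReal.toReal_ofReal hμ.1.le, ENNReal.toReal_ofReal (sub_nonneg.2 hμ.2.le)]

lemma bernoulliReal_apply_eq_one {μ : ℝ} (hμ : μ ∈ Set.Ioo (0 : ℝ) 1) {s : Set ℝ}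
    (h0 : (0 : ℝ) ∈ s) (h1 : (1 : ℝ) ∈ s) : bernoulliReal μ s = 1 := by
  simp [bernoulliReal, Measure.dirac_apply_of_mem h0, Measure.dirac_apply_of_mem h1,
    ← ENNReal.ofReal_add (sub_nonneg.2 hμ.2.le) hμ.1.le]

/-- Minimax identity of Theorem 1: for `ξ ∈ (0,1)` and `μ ∈ (ξ,1)`, the infimum over all
probability measures on `ℝ` supported on `[0,1]` with mean `μ` of the supremum over
`l ∈ [0, 1/ξ)` of `∫ log (1 + l (x - ξ)) dP` equals the Bernoulli KL divergence
`d(μ,ξ) = μ log (μ/ξ) + (1-μ) log ((1-μ)/(1-ξ))`. -/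
theorem stmt_5 (ξ μ : ℝ) (hξ : ξ ∈ Set.Ioo (0:ℝ) 1) (hμ : μ ∈ Set.Ioo ξ 1) :
    sInf {y : ℝ | ∃ P : Measure ℝ, ∃ _ : IsProbabilityMeasure P,
        P (Set.Icc (0:ℝ) 1) = 1 ∧ (∫ x, x ∂P) = μ ∧
        y = ⨆ l : Set.Ico (0:ℝ) (1/ξ), ∫ x, Real.log (1 + (l : ℝ) * (x - ξ)) ∂P}
      = μ * Real.log (μ / ξ) + (1 - μ) * Real.log ((1 - μ) / (1 - ξ)) := by
  have hμ01 : μ ∈ Set.Ioo (0 : ℝ) 1 := ⟨hξ.1.trans hμ.1, hμ.2⟩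
  have hopt := optimal_bet_mem_Ico hξ hμ
  have lower (P : Measure ℝ) [IsProbabilityMeasure P] (hP : P (Set.Icc (0 : ℝ) 1) = 1)
      (hmean : ∫ x, x ∂P = μ) :
      μ * Real.log (μ / ξ) + (1 - μ) * Real.log ((1 - μ) / (1 - ξ))
        ≤ ⨆ l : Set.Ico (0:ℝ) (1/ξ), ∫ x, Real.log (1 + (l : ℝ) * (x - ξ)) ∂P := by
    rw [← bernoulli_growth_optimal_bet hξ]
    exact (bernoulli_growth_le_integral_log hξ hopt P hP hmean).trans
      (le_ciSup (bddAbove_range_integral_log hξ P hP) ⟨_, hopt⟩)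
  refine IsLeast.csInf_eq ⟨?_, ?_⟩
  · have hprob : IsProbabilityMeasure (bernoulliReal μ) :=
      ⟨bernoulliReal_apply_eq_one hμ01 (Set.mem_univ _) (Set.mem_univ _)⟩
    have hsupp : bernoulliReal μ (Set.Icc (0 : ℝ) 1) = 1 :=
      bernoulliReal_apply_eq_one hμ01 (by simp) (by simp)
    have hmean : ∫ x, x ∂(bernoulliReal μ) = μ := by
      simp [integral_bernoulliReal hμ01 fun x => x]
    have : Nonempty (Set.Ico (0 : ℝ) (1 / ξ)) := ⟨⟨_, hopt⟩⟩
    refine ⟨bernoulliReal μ, hprob, hsupp, hmean,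
      (lower _ hsupp hmean).antisymm (ciSup_le fun l => ?_)⟩
    rw [integral_bernoulliReal hμ01]
    exact bernoulli_growth_le hξ hμ01 l.2
  · rintro _ ⟨P, _, hP, hmean, rfl⟩
    exact lower P hP hmean
end
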